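/- arXiv:1303.2680 — 6 statements merged into one kernel-verified Lean document; each statement's English description precedes it below -/
import Mathlib

section
/- Let d ≥ 1 and let Ψ₁, Ψ₂ : ℂ^d → ℝ be functions such that (i) Ψ₁(0) = Ψ₂(0), (ii) for every t ∈ ℝ and every z ∈ ℂ^d one has Ψ₁(e^{it}·z) = Ψ₁(z) and Ψ₂(e^{it}·z) = Ψ₂(z), and (iii) there exists an entire function f : ℂ^d → ℂ with Ψ₁(z) − Ψ₂(z) = Re f(z) for all z ∈ ℂ^d. Then Ψ₁ = Ψ₂. -/
/-- An entire function on `ℂ` whose real part is constant on the unit circle has the same real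
part at `0` and at `1`. -/
theorem Differentiable.re_zero_eq_re_one {g : ℂ → ℂ} (hg : Differentiable ℂ g)
    (h : ∀ t : ℝ, (g (Complex.exp (t * Complex.I))).re = (g 1).re) :
    (g 0).re = (g 1).re := by
  have hharm : InnerProductSpace.HarmonicOnNhd (fun w => (g w).re)
      (Metric.closedBall 0 |(1 : ℝ)|) := fun w _ => (hg.analyticAt w).harmonicAt_re
  rw [← hharm.circleAverage_eq]
  refine Real.circleAverage_const_on_circle fun w hw => ?_
  rw [abs_one, mem_sphere_zero_iff_norm] at hw
  rw [← h w.arg]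
  congr 2
  simpa [hw] using (Complex.norm_mul_exp_arg_mul_I w).symm

/-- Two circle-invariant functions on ℂ^d that agree at 0 and differ by the real
part of an entire function must be equal (uniqueness of circle-invariant Kähler
potentials). -/
theorem stmt_0 (d : ℕ) (hd : 1 ≤ d) (Ψ₁ Ψ₂ : (Fin d → ℂ) → ℝ)
    (h0 : Ψ₁ 0 = Ψ₂ 0)
    (hinv₁ : ∀ (t : ℝ) (z : Fin d → ℂ),
      Ψ₁ (fun j => Complex.exp (t * Complex.I) * z j) = Ψ₁ z)
    (hinv₂ : ∀ (t : ℝ) (z : Fin d → ℂ),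
      Ψ₂ (fun j => Complex.exp (t * Complex.I) * z j) = Ψ₂ z)
    (f : (Fin d → ℂ) → ℂ) (hf : Differentiable ℂ f)
    (hdiff : ∀ z, Ψ₁ z - Ψ₂ z = (f z).re) :
    Ψ₁ = Ψ₂ := by
  funext z
  have hg : Differentiable ℂ fun w : ℂ => f (w • z) := by fun_prop
  have key := hg.re_zero_eq_re_one fun t => by
    rw [one_smul, ← hdiff, ← hdiff, ← hinv₁ t z, ← hinv₂ t z]
    rfl
  rw [zero_smul, one_smul, ← hdiff, ← hdiff, h0, sub_self] at key
  exact sub_eq_zero.mp key.symm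
end

section
/- Let d ≥ 1 and let f : ℂ^d → ℂ be an entire function such that Re f(e^{it}·z) = Re f(z) for all t ∈ ℝ and all z ∈ ℂ^d. Then f is constant, i.e., there exists c ∈ ℂ with f(z) = c for all z ∈ ℂ^d. -/
/-- If the real part of an entire function is bounded above by `C` on the unit circle, then so is
its value at the origin. -/
lemma re_apply_zero_le_of_forall_norm_eq_one {g : ℂ → ℂ} (hg : Differentiable ℂ g) {C : ℝ}
    (hC : ∀ w : ℂ, ‖w‖ = 1 → (g w).re ≤ C) : (g 0).re ≤ C := by
  have h : ‖Complex.exp (g 0)‖ ≤ Real.exp C := by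
    refine Complex.norm_le_of_forall_mem_frontier_norm_le (U := Metric.ball 0 1)
      (f := fun w => Complex.exp (g w)) Metric.isBounded_ball hg.cexp.diffContOnCl
      (fun w hw => ?_) (subset_closure (Metric.mem_ball_self one_pos))
    rw [frontier_ball _ one_ne_zero, mem_sphere_zero_iff_norm] at hw
    rw [Complex.norm_exp]
    exact Real.exp_le_exp.2 (hC w hw)
  rwa [Complex.norm_exp, Real.exp_le_exp] at h

/-- If the real part of an entire function is constant on the unit circle, then it takes the same
value at the origin. -/
lemma re_apply_zero_eq_of_forall_norm_eq_one {g : ℂ → ℂ} (hg : Differentiable ℂ g) {C : ℝ}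
    (hC : ∀ w : ℂ, ‖w‖ = 1 → (g w).re = C) : (g 0).re = C := by
  refine le_antisymm (re_apply_zero_le_of_forall_norm_eq_one hg fun w hw => (hC w hw).le) ?_
  have h := re_apply_zero_le_of_forall_norm_eq_one (C := -C) hg.neg fun w hw => by simp [hC w hw]
  simpa using h

/-- A holomorphic function on a complex normed space with constant real part is constant. -/
lemma Differentiable.eq_apply_zero_of_re_eq {E : Type*} [NormedAddCommGroup E] [NormedSpace ℂ E]
    {f : E → ℂ} (hf : Differentiable ℂ f) (hre : ∀ z, (f z).re = (f 0).re) (z : E) :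
    f z = f 0 := by
  have hg : Differentiable ℂ fun w : ℂ => f (w • z) := by fun_prop
  obtain ⟨c, hc⟩ := AnalyticOnNhd.eq_const_of_re_eq_const
    (fun w _ => hg.analyticAt w) (fun w _ => hre (w • z)) isOpen_univ isConnected_univ
  have h₁ := hc 1 (Set.mem_univ _)
  have h₀ := hc 0 (Set.mem_univ _)
  simp only [one_smul, zero_smul] at h₁ h₀
  exact h₁.trans h₀.symm

/-- An entire function on ℂ^d whose real part is invariant under the circle
action z ↦ e^{it}z is constant. -/
theorem stmt_1 (d : ℕ) (hd : 1 ≤ d) (f : (Fin d → ℂ) → ℂ)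
    (hf : Differentiable ℂ f)
    (hinv : ∀ (t : ℝ) (z : Fin d → ℂ),
      (f (fun j => Complex.exp (t * Complex.I) * z j)).re = (f z).re) :
    ∃ c : ℂ, ∀ z, f z = c := by
  refine ⟨f 0, hf.eq_apply_zero_of_re_eq fun z => ?_⟩
  have hg : Differentiable ℂ fun w : ℂ => f (w • z) := by fun_prop
  have h := re_apply_zero_eq_of_forall_norm_eq_one (C := (f z).re) hg fun w hw => by
    obtain ⟨t, rfl⟩ := (Complex.norm_eq_one_iff w).1 hw
    exact hinv t z
  simpa using h.symm
end

section
/- Let r ≥ 1 and let a, b, m ∈ ℕ, c ∈ ℤ, and set p := 2 + a(r−1) + b. Then the following identity of Lebesgue integrals with values in [0,∞] holds: ∫_{(0,∞)^r} ∏_{i=1}^r t_i^{2m+2b+1} (1+t_i²)^{−(2m+c+p)} · ∏_{1≤i<j≤r} |t_i² − t_j²|^a dt₁⋯dt_r = 2^{−r} · ∫_{(0,1)^r} ∏_{i=1}^r s_i^{m+b} (1−s_i)^{m+c} · ∏_{1≤i<j≤r} |s_i − s_j|^a ds₁⋯ds_r. -/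
open MeasureTheory
open scoped ENNReal

/-- Change of variables for a one-variable function acting on every coordinate. -/
theorem lintegral_pi_image_eq_lintegral_prod_abs_deriv_mul {ι : Type*} [Fintype ι]
    {f f' : ℝ → ℝ} {s : Set ℝ} (hs : MeasurableSet s)
    (hf' : ∀ x ∈ s, HasDerivAt f (f' x) x) (hf : Set.InjOn f s) (g : (ι → ℝ) → ℝ≥0∞) :
    ∫⁻ x in Set.univ.pi (fun _ : ι => f '' s), g x =
      ∫⁻ x in Set.univ.pi (fun _ : ι => s),
        ENNReal.ofReal (∏ i, |f' (x i)|) * g (fun i => f (x i)) := by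
  classical
  let F : (ι → ℝ) → ι → ℝ := fun x i => f (x i)
  let F' : (ι → ℝ) → (ι → ℝ) →L[ℝ] (ι → ℝ) := fun x =>
    ContinuousLinearMap.pi fun i => f' (x i) • ContinuousLinearMap.proj i
  have himage : F '' Set.univ.pi (fun _ => s) = Set.univ.pi (fun _ => f '' s) :=
    Set.piMap_image_univ_pi (fun _ => f) (fun _ => s)
  have hderiv : ∀ x ∈ Set.univ.pi (fun _ : ι => s),
      HasFDerivWithinAt F (F' x) (Set.univ.pi fun _ => s) x := by
    intro x hx
    refine HasFDerivAt.hasFDerivWithinAt (hasFDerivAt_pi.2 fun i => ?_)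
    exact (hf' (x i) (hx i trivial)).comp_hasFDerivAt x (hasFDerivAt_apply i x)
  have hinj : Set.InjOn F (Set.univ.pi fun _ => s) := fun x hx y hy hxy =>
    funext fun i => hf (hx i trivial) (hy i trivial) (congrFun hxy i)
  have hdet (x : ι → ℝ) : (F' x).det = ∏ i, f' (x i) := by
    have h : ((F' x : (ι → ℝ) →L[ℝ] (ι → ℝ)) : (ι → ℝ) →ₗ[ℝ] (ι → ℝ)) =
        Matrix.toLin' (Matrix.diagonal fun i => f' (x i)) := by
      refine LinearMap.ext fun v => funext fun i => ?_
      simp [F', Matrix.mulVec_diagonal]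
    rw [ContinuousLinearMap.det, h, LinearMap.det_toLin', Matrix.det_diagonal]
  rw [← himage, lintegral_image_eq_lintegral_abs_det_fderiv_mul volume
    (MeasurableSet.univ_pi fun _ => hs) hderiv hinj]
  simp only [hdet, Finset.abs_prod, F]

theorem hasDerivAt_sq_div_one_add_sq (t : ℝ) :
    HasDerivAt (fun t : ℝ => t ^ 2 / (1 + t ^ 2)) (2 * t / (1 + t ^ 2) ^ 2) t := by
  have h := (hasDerivAt_pow 2 t).div ((hasDerivAt_pow 2 t).const_add 1)
    (by positivity : (1 + t ^ 2 : ℝ) ≠ 0)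
  refine h.congr_deriv ?_
  congr 1
  norm_num
  ring

theorem injOn_sq_div_one_add_sq :
    Set.InjOn (fun t : ℝ => t ^ 2 / (1 + t ^ 2)) (Set.Ioi 0) := by
  intro x hx y hy h
  simp only [Set.mem_Ioi] at hx hy
  have h' : x ^ 2 / (1 + x ^ 2) = y ^ 2 / (1 + y ^ 2) := h
  rw [div_eq_div_iff (by positivity) (by positivity)] at h'
  exact (sq_eq_sq₀ hx.le hy.le).1 (by linarith)

theorem image_sq_div_one_add_sq :
    (fun t : ℝ => t ^ 2 / (1 + t ^ 2)) '' Set.Ioi 0 = Set.Ioo 0 1 := by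
  ext s
  constructor
  · rintro ⟨t, ht, rfl⟩
    have ht : 0 < t := ht
    exact ⟨by positivity, (div_lt_one (by positivity)).2 (by linarith)⟩
  · rintro ⟨h0, h1⟩
    have h1' : 0 < 1 - s := sub_pos.2 h1
    refine ⟨√(s / (1 - s)), Real.sqrt_pos.2 (by positivity), ?_⟩
    simp only [Real.sq_sqrt (by positivity : 0 ≤ s / (1 - s))]
    field_simp
    ring

theorem prod_prod_Ioi_mul_eq_prod_pow {M : Type*} [CommMonoid M] {r : ℕ} (u : Fin r → M) :
    ∏ i, ∏ j ∈ Finset.Ioi i, (u i * u j) = ∏ i, u i ^ (r - 1) := by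
  rw [Finset.prod_prod_Ioi_mul_eq_prod_prod_off_diag (fun _ i => u i)]
  simp [Finset.card_compl]

/-- The absolute difference of the new variables, raised to a power and multiplied over pairs. -/
theorem prod_prod_abs_sub_sq_div_one_add_sq {r : ℕ} (a : ℕ) (t : Fin r → ℝ) :
    ∏ i, ∏ j ∈ Finset.Ioi i,
        |t i ^ 2 / (1 + t i ^ 2) - t j ^ 2 / (1 + t j ^ 2)| ^ a =
      (∏ i, ((1 + t i ^ 2) ^ (a * (r - 1)))⁻¹) *
        ∏ i, ∏ j ∈ Finset.Ioi i, |t i ^ 2 - t j ^ 2| ^ a := by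
  have hpow : ∏ i, ((1 + t i ^ 2) ^ (a * (r - 1)))⁻¹ =
      ∏ i, ∏ j ∈ Finset.Ioi i, (((1 + t i ^ 2) ^ a)⁻¹ * ((1 + t j ^ 2) ^ a)⁻¹) := by
    rw [prod_prod_Ioi_mul_eq_prod_pow fun i => ((1 + t i ^ 2) ^ a)⁻¹]
    simp only [inv_pow, pow_mul]
  rw [hpow]
  simp only [← Finset.prod_mul_distrib]
  refine Finset.prod_congr rfl fun i _ => Finset.prod_congr rfl fun j _ => ?_
  have hi : 0 < 1 + t i ^ 2 := by positivity
  have hj : 0 < 1 + t j ^ 2 := by positivity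
  have h : t i ^ 2 / (1 + t i ^ 2) - t j ^ 2 / (1 + t j ^ 2) =
      (t i ^ 2 - t j ^ 2) / ((1 + t i ^ 2) * (1 + t j ^ 2)) := by
    field_simp
    ring
  rw [h, abs_div, abs_of_pos (mul_pos hi hj), div_pow, mul_pow, div_eq_mul_inv, mul_inv, mul_comm]

theorem deriv_mul_weight_sq_div_one_add_sq (k b m : ℕ) (c : ℤ) (t : ℝ) :
    2 * t / (1 + t ^ 2) ^ 2 *
        ((t ^ 2 / (1 + t ^ 2)) ^ (m + b) * (1 - t ^ 2 / (1 + t ^ 2)) ^ ((m : ℤ) + c)) *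
        ((1 + t ^ 2) ^ k)⁻¹ =
      2 * (t ^ (2 * m + 2 * b + 1) *
        (1 + t ^ 2) ^ (-(2 * (m : ℤ) + c + ((2 + k + b : ℕ) : ℤ)))) := by
  have hD : (1 + t ^ 2 : ℝ) ≠ 0 := by positivity
  have h1 : 1 - t ^ 2 / (1 + t ^ 2) = (1 + t ^ 2)⁻¹ := by
    field_simp
    ring
  have hexp : (1 + t ^ 2 : ℝ) ^ (-(2 * (m : ℤ) + c + ((2 + k + b : ℕ) : ℤ))) =
      ((1 + t ^ 2) ^ 2)⁻¹ * ((1 + t ^ 2) ^ (m + b))⁻¹ * ((1 + t ^ 2) ^ ((m : ℤ) + c))⁻¹ *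
        ((1 + t ^ 2) ^ k)⁻¹ := by
    simp only [← zpow_natCast (1 + t ^ 2), ← zpow_neg]
    rw [← zpow_add₀ hD, ← zpow_add₀ hD, ← zpow_add₀ hD]
    congr 1
    push_cast
    ring
  rw [h1, hexp, inv_zpow, div_pow]
  ring

/-- The multi-dimensional change of variables s_i = t_i²/(1+t_i²) for the
Selberg-type integral appearing in the proof of Theorem 2.2, with
p = 2 + a(r-1) + b. -/
theorem stmt_4 (r : ℕ) (hr : 1 ≤ r) (a b m : ℕ) (c : ℤ) (p : ℕ)
    (hp : p = 2 + a * (r - 1) + b) :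
    (∫⁻ t in Set.univ.pi (fun _ : Fin r => Set.Ioi (0 : ℝ)),
        ENNReal.ofReal
          ((∏ i, t i ^ (2 * m + 2 * b + 1) *
              (1 + t i ^ 2) ^ (-(2 * (m : ℤ) + c + (p : ℤ)))) *
            ∏ i, ∏ j ∈ Finset.Ioi i, |t i ^ 2 - t j ^ 2| ^ a)) =
    (2 : ℝ≥0∞)⁻¹ ^ r *
      ∫⁻ s in Set.univ.pi (fun _ : Fin r => Set.Ioo (0 : ℝ) 1),
        ENNReal.ofReal
          ((∏ i, s i ^ (m + b) * (1 - s i) ^ ((m : ℤ) + c)) *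
            ∏ i, ∏ j ∈ Finset.Ioi i, |s i - s j| ^ a) := by
  have htwo : (2 : ℝ≥0∞)⁻¹ ^ r * ENNReal.ofReal (2 ^ r) = 1 := by
    rw [ENNReal.ofReal_pow (by norm_num), ← mul_pow, ENNReal.ofReal_ofNat,
      ENNReal.inv_mul_cancel (by norm_num) (by norm_num), one_pow]
  rw [← image_sq_div_one_add_sq, lintegral_pi_image_eq_lintegral_prod_abs_deriv_mul
    measurableSet_Ioi (fun t _ => hasDerivAt_sq_div_one_add_sq t) injOn_sq_div_one_add_sq,
    ← lintegral_const_mul' _ _ (by finiteness)]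
  refine setLIntegral_congr_fun (MeasurableSet.univ_pi fun _ => measurableSet_Ioi) fun t ht => ?_
  have habs : ∏ i, |2 * t i / (1 + t i ^ 2) ^ 2| = ∏ i, 2 * t i / (1 + t i ^ 2) ^ 2 :=
    Finset.prod_congr rfl fun i _ => by
      have hi : 0 < t i := ht i trivial
      exact abs_of_pos (by positivity)
  have hprod := Finset.prod_congr (rfl : (Finset.univ : Finset (Fin r)) = _) fun i _ =>
    deriv_mul_weight_sq_div_one_add_sq (a * (r - 1)) b m c (t i)
  simp only [← hp] at hprod
  rw [Finset.prod_mul_distrib, Finset.prod_mul_distrib, Finset.prod_mul_distrib (f := fun _ => 2),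
    Finset.prod_const, Finset.card_univ, Fintype.card_fin] at hprod
  simp only [habs]
  rw [← ENNReal.ofReal_mul (Finset.prod_nonneg fun i _ => by
      have hi : 0 < t i := ht i trivial
      positivity), prod_prod_abs_sub_sq_div_one_add_sq, ← mul_assoc, ← mul_assoc, hprod,
    mul_assoc (2 ^ r), ENNReal.ofReal_mul (p := 2 ^ r) (by positivity), ← mul_assoc, htwo, one_mul]
end

section
/- Let r ≥ 1 and let a, b, m ∈ ℕ, c ∈ ℤ, and set p := 2 + a(r−1) + b. Then the Lebesgue integral ∫_{(0,∞)^r} ∏_{i=1}^r t_i^{2m+2b+1} (1+t_i²)^{−(2m+c+p)} · ∏_{1≤i<j≤r} |t_i² − t_j²|^a dt₁⋯dt_r is finite if and only if m + c ≥ 0. -/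
open MeasureTheory
open scoped ENNReal

theorem lintegral_pi_fin_prod (n : ℕ) (μ : Fin n → Measure ℝ) [∀ i, SigmaFinite (μ i)]
    (f : Fin n → ℝ → ℝ≥0∞) (hf : ∀ i, Measurable (f i)) :
    ∫⁻ t, ∏ i, f i (t i) ∂(Measure.pi μ) = ∏ i, ∫⁻ x, f i x ∂(μ i) := by
  induction n with
  | zero => simp
  | succ n ih =>
    rw [← ((measurePreserving_piFinSuccAbove μ 0).symm).lintegral_comp_emb
      (MeasurableEquiv.measurableEmbedding _)]
    simp only [MeasurableEquiv.piFinSuccAbove_symm_apply, Fin.insertNthEquiv,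
      Fin.prod_univ_succ, Fin.insertNth_zero, Equiv.coe_fn_mk, Fin.cons_succ, Fin.cons_zero,
      Fin.zero_succAbove]
    rw [← ih (fun i => μ i.succ) (fun i => f i.succ) (fun i => hf _)]
    exact lintegral_prod_mul (hf 0).aemeasurable
      (Finset.measurable_prod _ fun i _ => (hf _).comp (measurable_pi_apply i)).aemeasurable

theorem setLIntegral_univ_pi_prod {n : ℕ} (s : Fin n → Set ℝ) (f : Fin n → ℝ → ℝ≥0∞)
    (hf : ∀ i, Measurable (f i)) :
    ∫⁻ t in Set.univ.pi s, ∏ i, f i (t i) = ∏ i, ∫⁻ x in s i, f i x := by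
  rw [volume_pi, Measure.restrict_pi_pi, lintegral_pi_fin_prod _ _ _ hf]

theorem prod_abs_sq_sub_sq_le {r : ℕ} (t : Fin r → ℝ) (a : ℕ) :
    ∏ i, ∏ j ∈ Finset.Ioi i, |t i ^ 2 - t j ^ 2| ^ a ≤ ∏ i, (1 + t i ^ 2) ^ (a * (r - 1)) := by
  calc ∏ i, ∏ j ∈ Finset.Ioi i, |t i ^ 2 - t j ^ 2| ^ a
      ≤ ∏ i, ∏ j ∈ Finset.Ioi i, ((1 + t i ^ 2) ^ a * (1 + t j ^ 2) ^ a) := by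
        refine Finset.prod_le_prod (fun _ _ => by positivity) fun i _ =>
          Finset.prod_le_prod (fun _ _ => by positivity) fun j _ => ?_
        rw [← mul_pow]
        refine pow_le_pow_left₀ (abs_nonneg _) (abs_le.2 ⟨?_, ?_⟩) _ <;>
          nlinarith [mul_nonneg (sq_nonneg (t i)) (sq_nonneg (t j)), sq_nonneg (t i),
            sq_nonneg (t j)]
    _ = ∏ i, (1 + t i ^ 2) ^ (a * (r - 1)) := by
        refine (Finset.prod_prod_Ioi_mul_eq_prod_prod_off_diag
          (fun _ i => (1 + t i ^ 2) ^ a)).trans ?_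
        simp [Finset.card_compl, pow_mul]

theorem pow_mul_zpow_le {t : ℝ} (ht : 0 < t) (b m : ℕ) {c : ℤ} (h : 0 ≤ (m : ℤ) + c) :
    t ^ (2 * m + 2 * b + 1) * (1 + t ^ 2) ^ (-(2 * (m : ℤ) + c + 2 + b)) ≤ (1 + t ^ 2)⁻¹ := by
  have hq : 0 < 1 + t ^ 2 := by positivity
  have h1 : (1 : ℝ) ≤ 1 + t ^ 2 := by nlinarith
  calc _ = t * (t ^ 2) ^ (m + b) * (1 + t ^ 2) ^ (-(2 * (m : ℤ) + c + 2 + b)) := by ring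
    _ ≤ (1 + t ^ 2) * (1 + t ^ 2) ^ (m + b) * (1 + t ^ 2) ^ (-(2 * (m : ℤ) + c + 2 + b)) := by
      gcongr
      · nlinarith [sq_nonneg (t - 1)]
      · linarith
    _ = (1 + t ^ 2) ^ (-(m + c) - 1 : ℤ) := by
      rw [← zpow_natCast (1 + t ^ 2), ← zpow_one_add₀ hq.ne', ← zpow_add₀ hq.ne']
      congr 1; push_cast; ring
    _ ≤ (1 + t ^ 2) ^ (-1 : ℤ) := zpow_le_zpow_right₀ h1 (by omega)
    _ = _ := zpow_neg_one _

theorem le_pow_mul_zpow {t : ℝ} (ht : 1 < t) (b m : ℕ) {c : ℤ} (h : (m : ℤ) + c < 0) :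
    (1 / 2) ^ (m + b + 1) * t⁻¹ ≤
      t ^ (2 * m + 2 * b + 1) * (1 + t ^ 2) ^ (-(2 * (m : ℤ) + c + 2 + b)) := by
  have hq : 0 < 1 + t ^ 2 := by positivity
  have h1 : (1 : ℝ) ≤ 1 + t ^ 2 := by nlinarith
  have h2 : (1 / 2) * (1 + t ^ 2) ≤ t ^ 2 := by nlinarith
  refine ge_iff_le.1 ?_
  calc t ^ (2 * m + 2 * b + 1) * (1 + t ^ 2) ^ (-(2 * (m : ℤ) + c + 2 + b))
      = t⁻¹ * (t ^ 2) ^ (m + b + 1) * (1 + t ^ 2) ^ (-(2 * (m : ℤ) + c + 2 + b)) := by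
        field_simp; ring
    _ ≥ t⁻¹ * ((1 / 2) * (1 + t ^ 2)) ^ (m + b + 1) *
          (1 + t ^ 2) ^ (-(2 * (m : ℤ) + c + 2 + b)) := by gcongr
    _ = (1 / 2) ^ (m + b + 1) * t⁻¹ * (1 + t ^ 2) ^ (-(m + c) - 1 : ℤ) := by
      rw [mul_pow, ← zpow_natCast (1 + t ^ 2)]
      have : (1 + t ^ 2) ^ (-(m + c) - 1 : ℤ) = (1 + t ^ 2) ^ ((m + b + 1 : ℕ) : ℤ) *
          (1 + t ^ 2) ^ (-(2 * (m : ℤ) + c + 2 + b)) := by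
        rw [← zpow_add₀ hq.ne']; congr 1; push_cast; ring
      rw [this]; ring
    _ ≥ (1 / 2) ^ (m + b + 1) * t⁻¹ :=
      le_mul_of_one_le_right (by positivity) (one_le_zpow₀ h1 (by omega))

theorem setLIntegral_Ioi_ofReal_inv_eq_top {R : ℝ} (hR : 0 ≤ R) :
    ∫⁻ t in Set.Ioi R, ENNReal.ofReal t⁻¹ = ⊤ := by
  by_contra h
  refine not_integrableOn_Ioi_inv (a := R) ⟨by fun_prop, ?_⟩
  rw [hasFiniteIntegral_iff_ofReal]
  · exact lt_top_iff_ne_top.2 h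
  · filter_upwards [ae_restrict_mem measurableSet_Ioi] with t ht
    exact inv_nonneg.2 (hR.trans (le_of_lt ht))

theorem le_prod_abs_sq_sub_sq {n : ℕ} (t : Fin (n + 1) → ℝ) (a : ℕ)
    (h0 : 2 * (n + 2 : ℝ) < t 0)
    (hs : ∀ i : Fin n, t i.succ ∈ Set.Icc ((i : ℝ) + 1) ((i : ℝ) + 3 / 2)) :
    ((1 / 2) * (1 + t 0 ^ 2)) ^ (a * n) ≤
      ∏ i, ∏ j ∈ Finset.Ioi i, |t i ^ 2 - t j ^ 2| ^ a := by
  have hs' (i : Fin n) : 1 ≤ t i.succ ∧ t i.succ ≤ n + 2 := by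
    have h1 := (hs i).1
    have h2 := (hs i).2
    have h3 : (i : ℝ) ≤ n := by exact_mod_cast i.2.le
    have h4 : (0 : ℝ) ≤ (i : ℝ) := by positivity
    constructor <;> linarith
  rw [Fin.prod_univ_succ, ← mul_one (_ ^ (a * n))]
  have hn : (0 : ℝ) ≤ n := by positivity
  refine mul_le_mul ?_ ?_ zero_le_one (by positivity)
  · have hc : (Finset.Ioi (0 : Fin (n + 1))).card = n := by simp
    rw [pow_mul]
    have hconst : ((1 / 2 * (1 + t 0 ^ 2)) ^ a) ^ n =
        ∏ j ∈ Finset.Ioi (0 : Fin (n + 1)), (1 / 2 * (1 + t 0 ^ 2)) ^ a := by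
      rw [Finset.prod_const, hc]
    rw [hconst]
    refine Finset.prod_le_prod (fun _ _ => by positivity) fun j hj => ?_
    obtain ⟨k, rfl⟩ := Fin.exists_succ_eq.2 (Fin.ne_zero_of_lt (Finset.mem_Ioi.1 hj))
    refine pow_le_pow_left₀ (by positivity) (le_trans ?_ (le_abs_self _)) _
    obtain ⟨h1, h2⟩ := hs' k
    nlinarith
  · rw [← Finset.prod_const_one (s := (Finset.univ : Finset (Fin n)))]
    refine Finset.prod_le_prod (fun _ _ => zero_le_one) fun i _ => ?_
    rw [← Finset.prod_const_one (s := Finset.Ioi i.succ)]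
    refine Finset.prod_le_prod (fun _ _ => zero_le_one) fun j hj => ?_
    refine one_le_pow₀ ?_
    obtain ⟨k, rfl⟩ := Fin.exists_succ_eq.2 (Fin.ne_zero_of_lt (Finset.mem_Ioi.1 hj))
    have hik : i < k := by simpa using hj
    have hik' : (i : ℝ) + 1 ≤ k := by exact_mod_cast hik
    rw [abs_sub_comm]
    refine le_trans ?_ (le_abs_self _)
    nlinarith [(hs i).2, (hs k).1, (hs' i).1, (hs' k).1]

/-- Finiteness criterion for the Selberg-type integral of Theorem 2.2 /
Proposition 3.4, with p = 2 + a(r-1) + b: the integral is finite iff m + c ≥ 0. -/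
theorem stmt_5 (r : ℕ) (hr : 1 ≤ r) (a b m : ℕ) (c : ℤ) (p : ℕ)
    (hp : p = 2 + a * (r - 1) + b) :
    (∫⁻ t in Set.univ.pi (fun _ : Fin r => Set.Ioi (0 : ℝ)),
        ENNReal.ofReal
          ((∏ i, t i ^ (2 * m + 2 * b + 1) *
              (1 + t i ^ 2) ^ (-(2 * (m : ℤ) + c + (p : ℤ)))) *
            ∏ i, ∏ j ∈ Finset.Ioi i, |t i ^ 2 - t j ^ 2| ^ a)) ≠ ⊤ ↔
    0 ≤ (m : ℤ) + c := by
  have hzpow (x : ℝ) : (1 + x ^ 2) ^ (-(2 * (m : ℤ) + c + (p : ℤ))) * (1 + x ^ 2) ^ (a * (r - 1)) =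
      (1 + x ^ 2) ^ (-(2 * (m : ℤ) + c + 2 + b)) := by
    have hq : 0 < 1 + x ^ 2 := by positivity
    rw [← zpow_natCast (1 + x ^ 2), ← zpow_add₀ hq.ne', hp]
    congr 1; push_cast; ring
  constructor
  · intro hfin
    by_contra! hneg
    apply hfin
    obtain ⟨n, rfl⟩ : ∃ n, r = n + 1 := ⟨r - 1, by omega⟩
    simp only [Nat.add_sub_cancel] at hp hzpow
    set w : ℝ → ℝ := fun x => x ^ (2 * m + 2 * b + 1) *
      (1 + x ^ 2) ^ (-(2 * (m : ℤ) + c + (p : ℤ))) with hw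
    have hwm : Measurable w := by
      have : Measurable fun x : ℝ => (1 + x ^ 2) ^ (-(2 * (m : ℤ) + c + (p : ℤ))) :=
        Measurable.pow_const (by fun_prop) _
      fun_prop
    have hwpos {x : ℝ} (hx : 0 < x) : 0 < w x := by simp only [hw]; positivity
    let s : Fin (n + 1) → Set ℝ := Fin.cons (Set.Ioi (2 * (n + 2 : ℝ)))
      fun i => Set.Icc ((i : ℝ) + 1) ((i : ℝ) + 3 / 2)
    let f : Fin (n + 1) → ℝ → ℝ := Fin.cons (fun x => w x * ((1 / 2) * (1 + x ^ 2)) ^ (a * n))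
      fun _ => w
    have hfm (i) : Measurable (f i) := by
      refine Fin.cases ?_ (fun i => ?_) i
      · simp only [f, Fin.cons_zero]; fun_prop
      · simpa only [f, Fin.cons_succ] using hwm
    have hsm (i) : MeasurableSet (s i) := by
      refine Fin.cases ?_ (fun i => ?_) i
      · exact measurableSet_Ioi
      · exact measurableSet_Icc
    have hsub : Set.univ.pi s ⊆ Set.univ.pi fun _ => Set.Ioi (0 : ℝ) := by
      refine Set.pi_mono fun i _ => ?_
      refine Fin.cases ?_ (fun i => ?_) i
      · exact Set.Ioi_subset_Ioi (by positivity)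
      · intro x hx
        exact lt_of_lt_of_le (by positivity) hx.1
    have htop : ∫⁻ t in Set.univ.pi s, ∏ i, ENNReal.ofReal (f i (t i)) = ⊤ := by
      rw [setLIntegral_univ_pi_prod s (fun i x => ENNReal.ofReal (f i x))
        (fun i => (hfm i).ennreal_ofReal), Fin.prod_univ_succ]
      have hzero : ∫⁻ x in s 0, ENNReal.ofReal (f 0 x) = ⊤ := by
        rw [eq_top_iff]
        calc ⊤ = ENNReal.ofReal ((1 / 2) ^ (a * n) * (1 / 2) ^ (m + b + 1)) *
              ∫⁻ x in s 0, ENNReal.ofReal x⁻¹ := by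
              have : ∫⁻ x in s 0, ENNReal.ofReal x⁻¹ = ⊤ :=
                setLIntegral_Ioi_ofReal_inv_eq_top (by positivity)
              rw [this, ENNReal.mul_top]
              exact (ENNReal.ofReal_pos.2 (by positivity)).ne'
          _ = ∫⁻ x in s 0, ENNReal.ofReal ((1 / 2) ^ (a * n) * (1 / 2) ^ (m + b + 1)) *
              ENNReal.ofReal x⁻¹ := (lintegral_const_mul _ (by fun_prop)).symm
          _ ≤ _ := by
            refine setLIntegral_mono' (hsm 0) fun x hx => ?_
            have hx' : 2 * (n + 2 : ℝ) < x := hx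
            have hn : (0 : ℝ) ≤ n := by positivity
            rw [← ENNReal.ofReal_mul (by positivity)]
            refine ENNReal.ofReal_le_ofReal ?_
            have hle := le_pow_mul_zpow (show 1 < x by linarith) b m hneg
            calc _ = (1 / 2) ^ (a * n) * ((1 / 2) ^ (m + b + 1) * x⁻¹) := by ring
              _ ≤ _ := mul_le_mul_of_nonneg_left hle (by positivity)
              _ = f 0 x := by
                rw [← hzpow]
                simp only [f, Fin.cons_zero, hw, mul_pow]
                ring
      rw [hzero]
      refine ENNReal.top_mul (Finset.prod_ne_zero_iff.2 fun i _ => ne_of_gt ?_)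
      rw [setLIntegral_pos_iff (hfm _).ennreal_ofReal]
      have hsupp : s i.succ ⊆ Function.support fun x => ENNReal.ofReal (f i.succ x) := by
        intro x hx
        have hx0 : 0 < x := lt_of_lt_of_le (by positivity) hx.1
        exact (ENNReal.ofReal_pos.2 (hwpos hx0)).ne'
      rw [Set.inter_eq_right.2 hsupp]
      simp only [s, Fin.cons_succ, Real.volume_Icc]
      exact ENNReal.ofReal_pos.2 (by linarith)
    rw [eq_top_iff, ← htop]
    refine le_trans ?_ (lintegral_mono_set hsub)
    refine setLIntegral_mono' (MeasurableSet.univ_pi hsm) fun t ht => ?_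
    have ht0 : 2 * (n + 2 : ℝ) < t 0 := ht 0 trivial
    have hts (i : Fin n) : t i.succ ∈ Set.Icc ((i : ℝ) + 1) ((i : ℝ) + 3 / 2) :=
      ht i.succ trivial
    have htpos (i) : 0 < t i := hsub ht i trivial
    rw [← ENNReal.ofReal_prod_of_nonneg]
    · refine ENNReal.ofReal_le_ofReal ?_
      calc ∏ i, f i (t i) = (∏ i, w (t i)) * ((1 / 2) * (1 + t 0 ^ 2)) ^ (a * n) := by
            simp only [Fin.prod_univ_succ, f, Fin.cons_zero, Fin.cons_succ]; ring
        _ ≤ _ := mul_le_mul_of_nonneg_left (le_prod_abs_sq_sub_sq t a ht0 hts)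
            (Finset.prod_nonneg fun i _ => (hwpos (htpos i)).le)
    · intro i _
      have := htpos i
      revert this
      refine Fin.cases ?_ (fun i => ?_) i
      · intro h; exact mul_nonneg (hwpos h).le (by positivity)
      · intro h; exact (hwpos h).le
  · intro h
    refine ne_top_of_le_ne_top ?_ (setLIntegral_mono' (MeasurableSet.univ_pi fun _ => measurableSet_Ioi)
      (g := fun t => ∏ i, ENNReal.ofReal ((1 + t i ^ 2)⁻¹)) fun t ht => ?_)
    · rw [setLIntegral_univ_pi_prod _ (fun _ x => ENNReal.ofReal ((1 + x ^ 2)⁻¹))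
        (fun _ => by fun_prop)]
      refine ENNReal.prod_ne_top fun i _ => ?_
      exact ((integrable_inv_one_add_sq.integrableOn (s := Set.Ioi 0)).lintegral_lt_top).ne
    · have htpos (i) : 0 < t i := ht i trivial
      rw [← ENNReal.ofReal_prod_of_nonneg fun i _ => by positivity]
      refine ENNReal.ofReal_le_ofReal ?_
      calc _ ≤ (∏ i, t i ^ (2 * m + 2 * b + 1) *
              (1 + t i ^ 2) ^ (-(2 * (m : ℤ) + c + (p : ℤ)))) *
              ∏ i, (1 + t i ^ 2) ^ (a * (r - 1)) :=
            mul_le_mul_of_nonneg_left (prod_abs_sq_sub_sq_le t a)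
              (Finset.prod_nonneg fun i _ => by have := htpos i; positivity)
        _ = ∏ i, t i ^ (2 * m + 2 * b + 1) * (1 + t i ^ 2) ^ (-(2 * (m : ℤ) + c + 2 + b)) := by
            rw [← Finset.prod_mul_distrib]
            exact Finset.prod_congr rfl fun i _ => by rw [mul_assoc, hzpow]
        _ ≤ _ := Finset.prod_le_prod (fun i _ => by have := htpos i; positivity)
            fun i _ => pow_mul_zpow_le (htpos i) b m h
end

section
/- Let n ≥ 1 and let G and H be polynomials in n real variables x₁, …, x_n with real coefficients such that G ≠ 0 and H(x) > 0 for every x ∈ ℝⁿ. If the function x ↦ |G(x)| / H(x) is Lebesgue-integrable on ℝⁿ, then for every index i one has deg_{x_i} G + 2 ≤ deg_{x_i} H, where deg_{x_i} denotes the degree of a multivariate polynomial with respect to the variable x_i. -/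
open MeasureTheory

/-- If `|g| / h` is integrable on `ℝ` with `g ≠ 0` and `h` positive, then `h` has degree at least
two more than `g`. -/
theorem Polynomial.natDegree_add_two_le_of_integrable {g h : Polynomial ℝ} (hg : g ≠ 0)
    (hh : ∀ t, 0 < h.eval t) (hint : Integrable fun t => |g.eval t| / h.eval t) :
    g.natDegree + 2 ≤ h.natDegree := by
  by_contra! hlt
  have hdeg : h.degree ≤ (Polynomial.X * g).degree := by
    refine Polynomial.degree_le_natDegree.trans ?_
    rw [Polynomial.degree_eq_natDegree (mul_ne_zero Polynomial.X_ne_zero hg),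
      Polynomial.natDegree_X_mul hg]
    exact_mod_cast Nat.le_of_lt_succ hlt
  obtain ⟨c, hc⟩ := (Polynomial.isBigO_atTop_of_degree_le h (Polynomial.X * g) hdeg).bound
  have hO : (fun t : ℝ => t⁻¹) =O[Filter.atTop] fun t => |g.eval t| / h.eval t := by
    refine Asymptotics.IsBigO.of_bound c ?_
    filter_upwards [hc, Filter.eventually_gt_atTop 0] with t ht ht0
    have h0 := hh t
    rw [Polynomial.eval_mul, Polynomial.eval_X, norm_mul, Real.norm_of_nonneg h0.le,
      Real.norm_of_nonneg ht0.le, Real.norm_eq_abs] at ht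
    rw [Real.norm_of_nonneg (by positivity), Real.norm_of_nonneg (by positivity), ← mul_div_assoc,
      le_div_iff₀ h0, inv_mul_le_iff₀ ht0]
    linarith
  have hmeas : StronglyMeasurable fun t : ℝ => t⁻¹ := measurable_inv.stronglyMeasurable
  obtain ⟨s, hs, hs_int⟩ := hO.integrableAtFilter
    hmeas.stronglyMeasurableAtFilter (hint.integrableAtFilter Filter.atTop)
  obtain ⟨a, ha⟩ := Filter.mem_atTop_sets.1 hs
  exact not_integrableOn_Ioi_inv (hs_int.mono_set fun t (ht : a < t) => ha t ht.le)

/-- A property that holds almost everywhere holds at some point where a given nonzero polynomial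
does not vanish. -/
theorem MvPolynomial.exists_eval_ne_zero_of_ae {m : ℕ}
    {P : MvPolynomial (Fin m) ℝ} (hP : P ≠ 0) {p : (Fin m → ℝ) → Prop}
    (hp : ∀ᵐ y, p y) : ∃ y, p y ∧ MvPolynomial.eval y P ≠ 0 := by
  obtain ⟨y₀, hy₀⟩ : ∃ y, MvPolynomial.eval y P ≠ 0 := by
    by_contra! hzero
    exact hP (MvPolynomial.funext fun y => by simpa using hzero y)
  have hopen : IsOpen {y | MvPolynomial.eval y P ≠ 0} :=
    isOpen_ne_fun (MvPolynomial.continuous_eval P) continuous_const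
  obtain ⟨y, hy, hpy⟩ := (Measure.dense_of_ae hp).inter_open_nonempty _ hopen ⟨y₀, hy₀⟩
  exact ⟨y, hpy, hy⟩

/-- Fubini degree bound: if G, H are real polynomials in n variables with G ≠ 0,
H everywhere positive, and |G(x)|/H(x) is Lebesgue-integrable on ℝⁿ, then in each
variable the degree of G is at most the degree of H minus 2. -/
theorem stmt_7 (n : ℕ) (hn : 1 ≤ n) (G H : MvPolynomial (Fin n) ℝ)
    (hG : G ≠ 0) (hH : ∀ x : Fin n → ℝ, 0 < MvPolynomial.eval x H)
    (hint : Integrable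
      (fun x : Fin n → ℝ => |MvPolynomial.eval x G| / MvPolynomial.eval x H)) :
    ∀ i : Fin n, MvPolynomial.degreeOf i G + 2 ≤ MvPolynomial.degreeOf i H := by
  intro i
  obtain ⟨m, rfl⟩ : ∃ m, n = m + 1 := ⟨n - 1, by omega⟩
  have hinj : Function.Injective i.cycleRange := i.cycleRange.injective
  let slice (P : MvPolynomial (Fin (m + 1)) ℝ) :=
    MvPolynomial.finSuccEquiv ℝ m (MvPolynomial.rename i.cycleRange P)
  have natDegree_slice (P) : (slice P).natDegree = MvPolynomial.degreeOf i P := by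
    rw [MvPolynomial.natDegree_finSuccEquiv, ← Fin.cycleRange_self i,
      MvPolynomial.degreeOf_rename_of_injective hinj]
  have eval_slice (P) (t : ℝ) (y : Fin m → ℝ) :
      MvPolynomial.eval (i.insertNth t y : Fin (m + 1) → ℝ) P =
        ((slice P).map (MvPolynomial.eval y)).eval t := by
    rw [← MvPolynomial.eval_eq_eval_mv_eval', MvPolynomial.eval_rename]
    congr 2
    funext j
    exact (Fin.cons_apply_cycleRange t y i j).symm
  have hslice : slice G ≠ 0 := by
    simpa [slice] using fun h => hG (MvPolynomial.rename_injective _ hinj (by simpa using h))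
  have hprod : Integrable (fun z : ℝ × (Fin m → ℝ) =>
      |((slice G).map (MvPolynomial.eval z.2)).eval z.1| /
        ((slice H).map (MvPolynomial.eval z.2)).eval z.1) (volume.prod volume) := by
    have := (volume_preserving_piFinSuccAbove (fun _ => ℝ) i).symm.integrable_comp_of_integrable
      hint
    simp_rw [← eval_slice]
    exact this
  obtain ⟨y, hy, hlead⟩ := MvPolynomial.exists_eval_ne_zero_of_ae
    (Polynomial.leadingCoeff_ne_zero.2 hslice) hprod.prod_left_ae
  have hmap : (slice G).map (MvPolynomial.eval y) ≠ 0 := fun h => hlead <| by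
    rw [Polynomial.leadingCoeff, ← Polynomial.coeff_map, h, Polynomial.coeff_zero]
  have hdeg := Polynomial.natDegree_add_two_le_of_integrable
    hmap
    (fun t => by rw [← eval_slice]; exact hH _) hy
  rw [Polynomial.natDegree_map_of_leadingCoeff_ne_zero _ hlead, natDegree_slice] at hdeg
  exact hdeg.trans (Polynomial.natDegree_map_le.trans (natDegree_slice H).le)
end

section
/- Let r ≥ 1, let a, b ∈ ℕ, set p := 2 + a(r−1) + b, let λ : {1,…,r} → ℤ, and let P be a nonzero polynomial in r real variables t₁, …, t_r with real coefficients. If the Lebesgue integral ∫_{(0,∞)^r} P(t)² · ∏_{i=1}^r t_i^{2b+1} (1+t_i²)^{−(λ_i+p)} · ∏_{1≤i<j≤r} |t_i² − t_j²|^a dt₁⋯dt_r is finite, then for every index i one has (deg_{t_i} P : ℤ) ≤ λ_i, where deg_{t_i} denotes the degree of a multivariate polynomial with respect to the variable t_i. -/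
open MeasureTheory
open scoped ENNReal

open Filter Asymptotics

/-- Restricting a multivariate polynomial to the line through `s` in direction `i`. -/
noncomputable def lineRestriction {σ : Type*} [DecidableEq σ] (i : σ) (s : σ → ℝ)
    (P : MvPolynomial σ ℝ) : Polynomial ℝ :=
  MvPolynomial.aeval (Function.update (fun j => Polynomial.C (s j)) i Polynomial.X) P

theorem eval_lineRestriction {σ : Type*} [DecidableEq σ] (i : σ) (s : σ → ℝ)
    (P : MvPolynomial σ ℝ) (x : ℝ) :
    (lineRestriction i s P).eval x = MvPolynomial.eval (Function.update s i x) P := by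
  unfold lineRestriction
  induction P using MvPolynomial.induction_on with
  | C c => simp
  | add p q hp hq => simp [hp, hq]
  | mul_X p j hp =>
    simp only [map_mul, Polynomial.eval_mul, hp, MvPolynomial.aeval_X, MvPolynomial.eval_X]
    by_cases h : j = i
    · subst h; simp
    · simp [h]

theorem weight_single_one {σ : Type*} [DecidableEq σ] (i : σ) (m : σ →₀ ℕ) :
    Finsupp.weight (Pi.single i 1 : σ → ℕ) m = m i := by
  simp +contextual [Finsupp.weight_apply, Finsupp.sum, Pi.single_apply, eq_comm]

theorem pow_mul_coeff_lineRestriction {σ : Type*} [DecidableEq σ] (i : σ) (s : σ → ℝ)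
    (P : MvPolynomial σ ℝ) (n : ℕ) :
    s i ^ n * (lineRestriction i s P).coeff n =
      MvPolynomial.eval s (MvPolynomial.weightedHomogeneousComponent (Pi.single i 1) n P) := by
  induction P using MvPolynomial.induction_on' with
  | add p q hp hq =>
    simp only [lineRestriction, map_add, Polynomial.coeff_add, mul_add] at hp hq ⊢
    rw [hp, hq]
  | monomial m c =>
    have hline : lineRestriction i s (MvPolynomial.monomial m c) =
        Polynomial.C (c * (m.erase i).prod fun j e => s j ^ e) * Polynomial.X ^ m i := by
      rw [lineRestriction, MvPolynomial.aeval_monomial,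
        ← Finsupp.mul_prod_erase' m i _ fun _ => pow_zero _, Function.update_self]
      have : ((m.erase i).prod fun j e =>
          Function.update (fun j => Polynomial.C (s j)) i Polynomial.X j ^ e) =
          Polynomial.C ((m.erase i).prod fun j e => s j ^ e) := by
        rw [Finsupp.prod, Finsupp.prod, map_prod]
        refine Finset.prod_congr rfl fun j hj => ?_
        have hji : j ≠ i := by
          rintro rfl
          simp at hj
        rw [Function.update_of_ne hji, map_pow]
      rw [this, map_mul, Polynomial.algebraMap_eq]
      ring
    have hmono : MvPolynomial.IsWeightedHomogeneous (Pi.single i 1 : σ → ℕ)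
        (MvPolynomial.monomial m c) (m i) :=
      MvPolynomial.isWeightedHomogeneous_monomial _ m c (weight_single_one i m)
    rw [hline, Polynomial.coeff_C_mul_X_pow]
    by_cases hn : n = m i
    · rw [hn, hmono.weightedHomogeneousComponent_same, if_pos rfl, MvPolynomial.eval_monomial,
        ← Finsupp.mul_prod_erase' m i _ fun _ => pow_zero _]
      ring
    · rw [if_neg hn, hmono.weightedHomogeneousComponent_ne n hn, mul_zero, map_zero]

theorem weightedHomogeneousComponent_degreeOf_ne_zero {σ : Type*} [DecidableEq σ] (i : σ)
    {P : MvPolynomial σ ℝ} (hP : P ≠ 0) :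
    MvPolynomial.weightedHomogeneousComponent (Pi.single i 1) (P.degreeOf i) P ≠ 0 := by
  have hne : P.support.Nonempty := MvPolynomial.support_nonempty.mpr hP
  obtain ⟨m, hm, hmi⟩ := Finset.exists_mem_eq_sup P.support hne (fun m => m i)
  intro h
  have := MvPolynomial.coeff_weightedHomogeneousComponent
    (w := (Pi.single i 1 : σ → ℕ)) (n := P.degreeOf i) (φ := P) m
  rw [h, weight_single_one, MvPolynomial.degreeOf_eq_sup, hmi, if_pos rfl] at this
  exact MvPolynomial.mem_support_iff.mp hm this.symm

theorem pow_isBigO_eval_update {σ : Type*} [DecidableEq σ] (i : σ) (s : σ → ℝ)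
    (P : MvPolynomial σ ℝ) (n : ℕ)
    (h : MvPolynomial.eval s
      (MvPolynomial.weightedHomogeneousComponent (Pi.single i 1) n P) ≠ 0) :
    (fun x : ℝ => x ^ n) =O[atTop] fun x => MvPolynomial.eval (Function.update s i x) P := by
  rw [← pow_mul_coeff_lineRestriction] at h
  have hn := Polynomial.le_natDegree_of_ne_zero (right_ne_zero_of_mul h)
  have hlead : (lineRestriction i s P).leadingCoeff ≠ 0 := by
    rw [Polynomial.leadingCoeff_ne_zero]
    rintro h0
    simp [h0] at h
  simp_rw [← eval_lineRestriction]
  refine IsBigO.trans ?_ (Polynomial.isEquivalent_atTop_lead _).isBigO_symm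
  refine IsBigO.trans ?_ (isBigO_self_const_mul hlead _ _)
  refine IsBigO.of_bound 1 ?_
  filter_upwards [eventually_ge_atTop 1] with x hx
  rw [one_mul, norm_pow, norm_pow]
  exact pow_le_pow_right₀ (by rw [Real.norm_eq_abs]; exact hx.trans (le_abs_self x)) hn

theorem sq_isBigO_sq_sub (c : ℝ) : (fun x : ℝ => x ^ 2) =O[atTop] fun x => x ^ 2 - c := by
  refine IsBigO.of_bound 2 ?_
  filter_upwards [(tendsto_pow_atTop (α := ℝ) two_ne_zero).eventually_ge_atTop (2 * c)] with x hx
  rw [Real.norm_of_nonneg (sq_nonneg x), Real.norm_eq_abs]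
  linarith [le_abs_self (x ^ 2 - c)]

theorem sq_isTheta_one_add_sq : (fun x : ℝ => x ^ 2) =Θ[atTop] fun x => 1 + x ^ 2 := by
  refine ⟨IsBigO.of_bound 1 (Eventually.of_forall fun x => ?_), IsBigO.of_bound 2 ?_⟩
  · rw [Real.norm_of_nonneg (by positivity), Real.norm_of_nonneg (by positivity)]
    linarith
  · filter_upwards [eventually_ge_atTop 1] with x hx
    rw [Real.norm_of_nonneg (by positivity), Real.norm_of_nonneg (by positivity)]
    nlinarith

theorem pow_isBigO_abs_sq_sub_sq {σ : Type*} [DecidableEq σ] (i : σ) (s : σ → ℝ) (a : ℕ)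
    {j k : σ} (hjk : j ≠ k) (h : s j ^ 2 ≠ s k ^ 2) :
    (fun x : ℝ => x ^ (if j = i ∨ k = i then 2 * a else 0)) =O[atTop]
      fun x => |Function.update s i x j ^ 2 - Function.update s i x k ^ 2| ^ a := by
  by_cases hj : j = i
  · subst hj
    simp only [true_or, if_true, Function.update_self, Function.update_of_ne hjk.symm, pow_mul]
    exact ((sq_isBigO_sq_sub _).abs_right).pow a
  by_cases hk : k = i
  · subst hk
    simp only [or_true, if_true, Function.update_self, Function.update_of_ne hjk, pow_mul]
    simp_rw [abs_sub_comm (s j ^ 2)]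
    exact ((sq_isBigO_sq_sub _).abs_right).pow a
  · simp only [hj, hk, or_self, if_false, Function.update_of_ne hj, Function.update_of_ne hk,
      pow_zero]
    exact isBigO_const_const _ (pow_ne_zero _ (abs_ne_zero.mpr (sub_ne_zero.mpr h))) _

theorem sum_pairs_containing {r : ℕ} (i : Fin r) (c : ℕ) :
    ∑ j, ∑ k ∈ Finset.Ioi j, (if j = i ∨ k = i then c else 0) = c * (r - 1) := by
  have h : ∀ j : Fin r, ∑ k ∈ Finset.Ioi j, (if j = i ∨ k = i then c else 0) =
      (if j = i then (r - 1 - i) * c else 0) + if j < i then c else 0 := by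
    intro j
    rcases lt_trichotomy j i with hj | rfl | hj
    · simp [hj.ne, hj]
    · simp
    · have : ¬ j < i := hj.not_gt
      simp [hj.ne', this]
  simp_rw [h, Finset.sum_add_distrib]
  have hi : Finset.univ.filter (· < i) = Finset.Iio i := by ext; simp
  rw [Finset.sum_ite_eq' , ← Finset.sum_filter, hi]
  simp only [Finset.mem_univ, if_true, Finset.sum_const, Fin.card_Iio, smul_eq_mul]
  rw [← add_mul, mul_comm]
  congr 1
  omega

/-- The density of the squared L²-norm of `P` in polar coordinates. -/
noncomputable def polarIntegrand {r : ℕ} (a b p : ℕ) (lam : Fin r → ℤ)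
    (P : MvPolynomial (Fin r) ℝ) (t : Fin r → ℝ) : ℝ :=
  (MvPolynomial.eval t P) ^ 2 *
    (∏ i, t i ^ (2 * b + 1) * (1 + t i ^ 2) ^ (-(lam i + (p : ℤ)))) *
    ∏ i, ∏ j ∈ Finset.Ioi i, |t i ^ 2 - t j ^ 2| ^ a

theorem polarIntegrand_nonneg {r : ℕ} (a b p : ℕ) (lam : Fin r → ℤ)
    (P : MvPolynomial (Fin r) ℝ) {t : Fin r → ℝ} (ht : ∀ i, 0 ≤ t i) :
    0 ≤ polarIntegrand a b p lam P t := by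
  unfold polarIntegrand
  refine mul_nonneg (mul_nonneg (sq_nonneg _) (Finset.prod_nonneg fun i _ => ?_)) (by positivity)
  have := ht i
  positivity

theorem measurable_polarIntegrand {r : ℕ} (a b p : ℕ) (lam : Fin r → ℤ)
    (P : MvPolynomial (Fin r) ℝ) : Measurable (polarIntegrand a b p lam P) := by
  unfold polarIntegrand
  have hP : Measurable fun t => MvPolynomial.eval t P :=
    (MvPolynomial.continuous_eval P).measurable
  have hz (i : Fin r) (n : ℤ) : Measurable fun t : Fin r → ℝ => (1 + t i ^ 2) ^ n :=
    Continuous.measurable <| Continuous.zpow₀ (by fun_prop) n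
      fun t => Or.inl (by positivity)
  fun_prop

theorem prod_isBigO_polarIntegrand_update {r : ℕ} (a b p : ℕ) (lam : Fin r → ℤ)
    (P : MvPolynomial (Fin r) ℝ) (i : Fin r) (n : ℕ) (s : Fin r → ℝ) (hs : ∀ j, s j ≠ 0)
    (hsq : ∀ j k, j ≠ k → s j ^ 2 ≠ s k ^ 2)
    (h : MvPolynomial.eval s
      (MvPolynomial.weightedHomogeneousComponent (Pi.single i 1) n P) ≠ 0) :
    (fun x : ℝ => (x ^ n) ^ 2 * (x ^ (2 * b + 1) * (x ^ 2) ^ (-(lam i + (p : ℤ)))) *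
      x ^ (2 * a * (r - 1))) =O[atTop]
      fun x => polarIntegrand a b p lam P (Function.update s i x) := by
  unfold polarIntegrand
  refine ((pow_isBigO_eval_update i s P n h).pow 2 |>.mul ?_).mul ?_
  · have := IsBigO.finsetProd (s := Finset.univ) (l := atTop)
      (f := fun (j : Fin r) (x : ℝ) =>
        if j = i then x ^ (2 * b + 1) * (x ^ 2) ^ (-(lam i + (p : ℤ))) else 1)
      (g := fun j x => Function.update s i x j ^ (2 * b + 1) *
        (1 + Function.update s i x j ^ 2) ^ (-(lam j + (p : ℤ)))) ?_
    · simpa using this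
    · intro j _
      by_cases hj : j = i
      · subst hj
        simp only [if_true, Function.update_self]
        exact (isBigO_refl _ _).mul (sq_isTheta_one_add_sq.zpow _).isBigO
      · simp only [hj, if_false, Function.update_of_ne hj]
        refine isBigO_const_const _ (mul_ne_zero (pow_ne_zero _ (hs j)) ?_) _
        exact zpow_ne_zero _ (by positivity)
  · rw [← sum_pairs_containing i]
    simp_rw [← Finset.prod_pow_eq_pow_sum]
    refine IsBigO.finsetProd fun j _ => IsBigO.finsetProd fun k hk => ?_
    have hjk := (Finset.mem_Ioi.mp hk).ne
    exact pow_isBigO_abs_sq_sub_sq i s a hjk (hsq j k hjk)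

theorem not_integrableOn_Ioi_of_inv_isBigO {f : ℝ → ℝ}
    (h : (fun x : ℝ => x⁻¹) =O[atTop] f) (c : ℝ) : ¬ IntegrableOn f (Set.Ioi c) := by
  refine not_integrableOn_of_tendsto_norm_atTop_of_deriv_isBigO_filter atTop (Ioi_mem_atTop c)
    (f := Real.log) ?_ (tendsto_norm_atTop_atTop.comp Real.tendsto_log_atTop) ?_
  · filter_upwards [eventually_ne_atTop 0] with x hx using Real.differentiableAt_log hx
  · rwa [Real.deriv_log']

theorem inv_isBigO_of_lt {r : ℕ} (hr : 1 ≤ r) {a b p n : ℕ} (hp : p = 2 + a * (r - 1) + b)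
    {l : ℤ} (hl : l < n) :
    (fun x : ℝ => x⁻¹) =O[atTop] fun x : ℝ =>
      (x ^ n) ^ 2 * (x ^ (2 * b + 1) * (x ^ 2) ^ (-(l + (p : ℤ)))) * x ^ (2 * a * (r - 1)) := by
  refine IsBigO.of_bound 1 ?_
  filter_upwards [eventually_ge_atTop 1] with x hx
  have hx0 : x ≠ 0 := by positivity
  rw [one_mul, Real.norm_of_nonneg (by positivity), Real.norm_of_nonneg (by positivity)]
  have hpow : (x ^ n) ^ 2 * (x ^ (2 * b + 1) * (x ^ 2) ^ (-(l + (p : ℤ)))) *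
      x ^ (2 * a * (r - 1)) =
      x ^ ((n * 2 : ℕ) + (((2 * b + 1 : ℕ) : ℤ) + (2 : ℕ) * -(l + (p : ℤ))) +
        (2 * a * (r - 1) : ℕ)) := by
    rw [zpow_add₀ hx0, zpow_add₀ hx0, zpow_add₀ hx0, zpow_mul, zpow_natCast, zpow_natCast,
      zpow_natCast, zpow_natCast, pow_mul x n 2]
  rw [hpow, ← zpow_neg_one]
  refine zpow_le_zpow_right₀ hx ?_
  subst hp
  obtain ⟨q, rfl⟩ := Nat.exists_eq_add_of_le' hr
  rw [Nat.add_sub_cancel]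
  push_cast
  linarith

/-- Tonelli's theorem in one coordinate: almost every line section has finite integral. -/
theorem ae_lintegral_update_lt_top {ι : Type*} [Fintype ι] [DecidableEq ι] (i : ι)
    {f : (ι → ℝ) → ℝ≥0∞} (hf : Measurable f) (hfin : ∫⁻ t, f t ≠ ⊤) :
    ∀ᵐ s : ι → ℝ, s i ∈ Set.Ioo (0 : ℝ) 1 → ∫⁻ x, f (Function.update s i x) < ⊤ := by
  set g : (ι → ℝ) → ℝ≥0∞ := fun s => ∫⁻ x, f (Function.update s i x) with hg
  have hgm : Measurable g := by
    have := hf.lmarginal (s := {i}) (fun _ : ι => (volume : Measure ℝ))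
    rwa [lmarginal_singleton] at this
  have hS : MeasurableSet {s : ι → ℝ | s i ∈ Set.Ioo (0 : ℝ) 1} :=
    measurable_pi_apply i measurableSet_Ioo
  have key : ∫⁻ s, {s : ι → ℝ | s i ∈ Set.Ioo (0 : ℝ) 1}.indicator g s = ∫⁻ t, f t := by
    refine lintegral_eq_of_lmarginal_eq {i} (hgm.indicator hS) hf ?_
    rw [lmarginal_singleton, lmarginal_singleton]
    funext s
    have : ∀ x, {s : ι → ℝ | s i ∈ Set.Ioo (0 : ℝ) 1}.indicator g (Function.update s i x) =
        (Set.Ioo (0 : ℝ) 1).indicator (fun _ => g s) x := by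
      intro x
      simp [Set.indicator_apply, hg]
    simp_rw [this]
    rw [lintegral_indicator measurableSet_Ioo]
    simp [hg]
  filter_upwards [ae_lt_top (hgm.indicator hS) (key ▸ hfin)] with s hs hsi
  rwa [Set.indicator_of_mem (show s ∈ {s : ι → ℝ | s i ∈ Set.Ioo (0 : ℝ) 1} from hsi)] at hs

theorem exists_mem_cube_eval_ne_zero_of_ae {ι : Type*} [Fintype ι] {W : MvPolynomial ι ℝ}
    (hW : W ≠ 0) {p : (ι → ℝ) → Prop} (hp : ∀ᵐ s, p s) :
    ∃ s, (∀ i, s i ∈ Set.Ioo (0 : ℝ) 1) ∧ MvPolynomial.eval s W ≠ 0 ∧ p s := by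
  set U : Set (ι → ℝ) := Set.univ.pi (fun _ => Set.Ioo (0 : ℝ) 1) ∩
    {s | MvPolynomial.eval s W ≠ 0} with hU
  have hopen : IsOpen U := (isOpen_set_pi Set.finite_univ fun _ _ => isOpen_Ioo).inter
    (isOpen_ne_fun (MvPolynomial.continuous_eval W) continuous_const)
  have hne : U.Nonempty := by
    by_contra h
    refine hW (MvPolynomial.funext_set (fun _ => Set.Ioo (0 : ℝ) 1)
      (fun _ => Set.Ioo_infinite one_pos) fun x hx => ?_)
    by_contra hx0
    exact h ⟨x, hx, by simpa using hx0⟩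
  have hfreq : ∃ᵐ s, s ∈ U :=
    frequently_ae_mem_iff.mpr (hopen.measure_pos volume hne).ne'
  obtain ⟨s, hsU, hs⟩ := (hfreq.and_eventually hp).exists
  exact ⟨s, fun i => hsU.1 i (Set.mem_univ i), hsU.2, hs⟩

theorem X_sq_sub_X_sq_ne_zero {σ : Type*} {j k : σ} (h : j ≠ k) :
    (MvPolynomial.X j ^ 2 - MvPolynomial.X k ^ 2 : MvPolynomial σ ℝ) ≠ 0 := by
  classical
  intro h0
  have := congrArg (MvPolynomial.eval (Pi.single j (1 : ℝ))) h0
  simp [h.symm] at this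

/-- The necessary degree condition of Proposition 3.4: if the polar-coordinate
L²-integral of a nonzero polynomial weight vector is finite, then its degree in
each variable t_i is bounded by λ_i.  Here p = 2 + a(r-1) + b. -/
theorem stmt_8 (r : ℕ) (hr : 1 ≤ r) (a b : ℕ) (p : ℕ)
    (hp : p = 2 + a * (r - 1) + b)
    (lam : Fin r → ℤ) (P : MvPolynomial (Fin r) ℝ) (hP : P ≠ 0)
    (hfin : (∫⁻ t in Set.univ.pi (fun _ : Fin r => Set.Ioi (0 : ℝ)),
        ENNReal.ofReal
          ((MvPolynomial.eval t P) ^ 2 *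
            (∏ i, t i ^ (2 * b + 1) * (1 + t i ^ 2) ^ (-(lam i + (p : ℤ)))) *
            ∏ i, ∏ j ∈ Finset.Ioi i, |t i ^ 2 - t j ^ 2| ^ a)) ≠ ⊤) :
    ∀ i : Fin r, (MvPolynomial.degreeOf i P : ℤ) ≤ lam i := by
  intro i
  by_contra hlt
  rw [not_le] at hlt
  set n := MvPolynomial.degreeOf i P
  set S : Set (Fin r → ℝ) := Set.univ.pi (fun _ : Fin r => Set.Ioi (0 : ℝ)) with hSdef
  have hS : MeasurableSet S := MeasurableSet.univ_pi fun _ => measurableSet_Ioi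
  set F : (Fin r → ℝ) → ℝ≥0∞ :=
    S.indicator fun t => ENNReal.ofReal (polarIntegrand a b p lam P t) with hF
  have hFm : Measurable F :=
    (measurable_polarIntegrand a b p lam P).ennreal_ofReal.indicator hS
  have hFfin : ∫⁻ t, F t ≠ ⊤ := by
    rwa [hF, lintegral_indicator hS]
  set Q := MvPolynomial.weightedHomogeneousComponent (Pi.single i 1) n P
  have hW : Q * ∏ q : Fin r × Fin r with q.1 ≠ q.2,
      (MvPolynomial.X q.1 ^ 2 - MvPolynomial.X q.2 ^ 2 : MvPolynomial (Fin r) ℝ) ≠ 0 :=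
    mul_ne_zero (weightedHomogeneousComponent_degreeOf_ne_zero i hP)
      (Finset.prod_ne_zero_iff.mpr fun q hq => X_sq_sub_X_sq_ne_zero (by simpa using hq))
  obtain ⟨s, hs01, hsW, hsfin⟩ :=
    exists_mem_cube_eval_ne_zero_of_ae hW (ae_lintegral_update_lt_top i hFm hFfin)
  rw [map_mul, map_prod] at hsW
  have hsq : ∀ j k, j ≠ k → s j ^ 2 ≠ s k ^ 2 := fun j k hjk h =>
    Finset.prod_ne_zero_iff.mp (right_ne_zero_of_mul hsW) (j, k) (by simpa using hjk)
      (by simp [h])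
  have hO := (inv_isBigO_of_lt hr hp hlt).trans
    (prod_isBigO_polarIntegrand_update a b p lam P i n s (fun j => (hs01 j).1.ne') hsq
      (left_ne_zero_of_mul hsW))
  have hmem : ∀ x, Function.update s i x ∈ S ↔ x ∈ Set.Ioi (0 : ℝ) := by
    intro x
    refine ⟨fun h => by simpa using h i (Set.mem_univ i), fun hx j _ => ?_⟩
    by_cases hj : j = i
    · subst hj; simpa using hx
    · simpa [hj] using (hs01 j).1
  refine not_integrableOn_Ioi_of_inv_isBigO hO 0 ⟨?_, ?_⟩
  · exact ((measurable_polarIntegrand a b p lam P).comp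
      (measurable_update s)).aestronglyMeasurable
  · rw [hasFiniteIntegral_iff_ofReal, ← lintegral_indicator measurableSet_Ioi]
    · refine (lintegral_congr fun x => ?_).trans_lt (hsfin (hs01 i))
      by_cases hx : x ∈ Set.Ioi (0 : ℝ)
      · rw [hF, Set.indicator_of_mem hx, Set.indicator_of_mem ((hmem x).mpr hx)]
      · rw [hF, Set.indicator_of_notMem hx, Set.indicator_of_notMem ((hmem x).not.mpr hx)]
    · filter_upwards [ae_restrict_mem measurableSet_Ioi] with x hx
      exact polarIntegrand_nonneg a b p lam P fun j => ((hmem x).mpr hx j (Set.mem_univ j)).le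
end
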